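/- Define f(q) := (1/4)(q^{−1/2} − q^{1/2}) θ₂(q)² for 0 < q < 1. Then f is strictly decreasing on the interval (0, 1). -/

import Mathlib

open Complex Filter Metric Set Topology Bornology MeasureTheory

noncomputable section

/-- The Jacobi theta function `θ₂(q) = Σ_{n ∈ ℤ} q^{(n+1/2)²}` for real `q`. -/
def jacobiTheta2R (q : ℝ) : ℝ := ∑' n : ℤ, q ^ (((n : ℝ) + 1 / 2) ^ 2)


namespace ThetaAux

lemma pos_of_deriv {g g' : ℝ → ℝ} (hg : ∀ y, HasDerivAt g (g' y) y) (h0 : g 0 = 0)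
    (hp : ∀ y, 0 < y → 0 < g' y) : ∀ y, 0 < y → 0 < g y := by
  intro y hy
  have hm : StrictMonoOn g (Set.Ici 0) := by
    apply strictMonoOn_of_deriv_pos (convex_Ici 0)
    · exact fun z _ => (hg z).continuousAt.continuousWithinAt
    · intro z hz
      rw [interior_Ici] at hz
      rw [(hg z).deriv]
      exact hp z hz
  have := hm (Set.mem_Ici.2 le_rfl) (Set.mem_Ici.2 hy.le) hy
  rwa [h0] at this

lemma key_ineq : ∀ y : ℝ, 0 < y →
    0 < y * (Real.exp y ^ 2 + 4 * Real.exp y + 1) - 3 * Real.exp y ^ 2 + 3 := by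
  have hE : ∀ y : ℝ, HasDerivAt Real.exp (Real.exp y) y := Real.hasDerivAt_exp
  have h1 : ∀ y : ℝ, 0 < y → 0 < 1 + (y - 1) * Real.exp y := by
    refine pos_of_deriv (g' := fun y => y * Real.exp y) (fun y => ?_) (by simp)
      (fun y hy => by positivity)
    have := (((hasDerivAt_id y).sub_const 1).mul (hE y)).const_add 1
    refine this.congr_deriv ?_
    simp; ring
  have h2 : ∀ y : ℝ, 0 < y → 0 < y * (Real.exp y + 1) - 2 * Real.exp y + 2 := by
    refine pos_of_deriv (fun y => ?_) (by simp) h1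
    have := (((hasDerivAt_id y).mul ((hE y).add_const 1)).sub ((hE y).const_mul 2)).add_const 2
    refine this.congr_deriv ?_
    simp; ring
  have h3 : ∀ y : ℝ, 0 < y →
      0 < y * (2 * Real.exp y ^ 2 + 4 * Real.exp y) - 5 * Real.exp y ^ 2 + 4 * Real.exp y + 1 := by
    refine pos_of_deriv
      (g' := fun y => 4 * Real.exp y * (y * (Real.exp y + 1) - 2 * Real.exp y + 2))
      (fun y => ?_) (by simp; norm_num)
      (fun y hy => mul_pos (by positivity) (h2 y hy))
    have := (((((hasDerivAt_id y).mul ((((hE y).pow 2).const_mul 2).add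
      ((hE y).const_mul 4)))).sub (((hE y).pow 2).const_mul 5)).add
      ((hE y).const_mul 4)).add_const 1
    refine this.congr_deriv ?_
    simp; ring
  refine pos_of_deriv (fun y => ?_) (by simp) h3
  have := ((((hasDerivAt_id y).mul ((((hE y).pow 2).add
      ((hE y).const_mul 4)).add_const 1))).sub (((hE y).pow 2).const_mul 3)).add_const 3
  refine this.congr_deriv ?_
  simp; ring

def u (y : ℝ) : ℝ := (Real.exp y - 1)⁻¹

lemma exp_sub_pos {y : ℝ} (hy : 0 < y) : 0 < Real.exp y - 1 := by
  have := Real.add_one_lt_exp hy.ne'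
  linarith

lemma u_pos {y : ℝ} (hy : 0 < y) : 0 < u y := inv_pos.2 (exp_sub_pos hy)

lemma hasDerivAt_u {y : ℝ} (hy : 0 < y) : HasDerivAt u (-(u y + u y ^ 2)) y := by
  have hp := exp_sub_pos hy
  have := ((Real.hasDerivAt_exp y).sub_const 1).inv hp.ne'
  refine this.congr_deriv ?_
  unfold u
  field_simp
  ring

def h (y : ℝ) : ℝ := y * u y
def h1 (y : ℝ) : ℝ := u y - y * (u y + u y ^ 2)
def h2 (y : ℝ) : ℝ := -2 * (u y + u y ^ 2) + y * ((1 + 2 * u y) * (u y + u y ^ 2))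

lemma hasDerivAt_h {y : ℝ} (hy : 0 < y) : HasDerivAt h (h1 y) y := by
  have := (hasDerivAt_id y).mul (hasDerivAt_u hy)
  refine this.congr_deriv ?_
  simp [h1]; ring

lemma hasDerivAt_h1 {y : ℝ} (hy : 0 < y) : HasDerivAt h1 (h2 y) y := by
  have hu := hasDerivAt_u hy
  have := hu.sub ((hasDerivAt_id y).mul (hu.add (hu.pow 2)))
  refine this.congr_deriv ?_
  simp [h2]; ring

lemma hasDerivAt_h2 {y : ℝ} (hy : 0 < y) : HasDerivAt h2
    ((u y + u y ^ 2) * (3 * (1 + 2 * u y) - y * (1 + 6 * u y + 6 * u y ^ 2))) y := by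
  have hu := hasDerivAt_u hy
  have := ((hu.add (hu.pow 2)).const_mul (-2)).add ((hasDerivAt_id y).mul
    (((hu.const_mul 2).const_add 1).mul (hu.add (hu.pow 2))))
  refine this.congr_deriv ?_
  simp; ring

lemma h3_neg {y : ℝ} (hy : 0 < y) :
    (u y + u y ^ 2) * (3 * (1 + 2 * u y) - y * (1 + 6 * u y + 6 * u y ^ 2)) < 0 := by
  have hu := u_pos hy
  have hp := exp_sub_pos hy
  apply mul_neg_of_pos_of_neg (by positivity)
  have hk := key_ineq y hy
  have : 3 * (1 + 2 * u y) - y * (1 + 6 * u y + 6 * u y ^ 2) =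
      -((y * (Real.exp y ^ 2 + 4 * Real.exp y + 1) - 3 * Real.exp y ^ 2 + 3) /
        (Real.exp y - 1) ^ 2) := by
    unfold u
    field_simp
    ring
  rw [this, neg_lt_zero]
  positivity

lemma h2_anti : StrictAntiOn h2 (Set.Ioi 0) := by
  apply strictAntiOn_of_deriv_neg (convex_Ioi 0)
  · exact fun z hz => (hasDerivAt_h2 hz).continuousAt.continuousWithinAt
  · intro z hz
    rw [interior_Ioi] at hz
    rw [(hasDerivAt_h2 hz).deriv]
    exact h3_neg hz

lemma h1_diff {s : ℝ} (hs : 0 < s) : StrictAntiOn (fun y => h1 (y + s) - h1 y) (Set.Ioi 0) := by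
  have hd : ∀ z, 0 < z → HasDerivAt (fun y => h1 (y + s) - h1 y) (h2 (z + s) - h2 z) z := by
    intro z hz
    exact ((hasDerivAt_h1 (by positivity : 0 < z + s)).comp_add_const z s).sub (hasDerivAt_h1 hz)
  apply strictAntiOn_of_deriv_neg (convex_Ioi 0)
  · exact fun z hz => (hd z hz).continuousAt.continuousWithinAt
  · intro z hz
    rw [interior_Ioi] at hz
    have hz : 0 < z := hz
    rw [(hd z hz).deriv, sub_neg]
    exact h2_anti hz (by simp; positivity) (by linarith)

lemma h_diff {s : ℝ} (hs : 0 < s) :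
    StrictAntiOn (fun y => h y - 2 * h (y + s) + h (y + (s + s))) (Set.Ioi 0) := by
  have hd : ∀ z, 0 < z → HasDerivAt (fun y => h y - 2 * h (y + s) + h (y + (s + s)))
      (h1 z - 2 * h1 (z + s) + h1 (z + (s + s))) z := by
    intro z hz
    exact ((hasDerivAt_h hz).sub
      (((hasDerivAt_h (by positivity : 0 < z + s)).comp_add_const z s).const_mul 2)).add
      ((hasDerivAt_h (by positivity : 0 < z + (s + s))).comp_add_const z (s + s))
  apply strictAntiOn_of_deriv_neg (convex_Ioi 0)
  · exact fun z hz => (hd z hz).continuousAt.continuousWithinAt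
  · intro z hz
    rw [interior_Ioi] at hz
    have hz : 0 < z := hz
    rw [(hd z hz).deriv]
    have := h1_diff hs (Set.mem_Ioi.2 hz) (Set.mem_Ioi.2 (by positivity : 0 < z + s))
      (by linarith)
    simp only [add_assoc] at this
    linarith

lemma h_ineq {y s : ℝ} (hy : 0 < y) (hs : 0 < s) :
    0 < h y - 2 * h (y + s) + 2 * h (y + 3 * s) - h (y + 4 * s) := by
  have := h_diff hs (Set.mem_Ioi.2 hy) (Set.mem_Ioi.2 (by positivity : 0 < y + (s + s)))
      (by linarith)
  simp only at this
  rw [show y + (s + s) + s = y + 3 * s by ring, show y + (s + s) + (s + s) = y + 4 * s by ring]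
    at this
  linarith

lemma pow_h {q : ℝ} (hq : q ∈ Set.Ioo (0:ℝ) 1) (k : ℕ) (hk : k ≠ 0) :
    (k * q ^ (k-1) / (1 - q ^ k)) * (q * (-Real.log q)) = h (k * (-Real.log q)) := by
  obtain ⟨h0, h1⟩ := hq
  have hlt : q ^ k < 1 := pow_lt_one₀ h0.le h1 hk
  have e : Real.exp (k * (-Real.log q)) = (q ^ k)⁻¹ := by
    rw [mul_neg, Real.exp_neg, mul_comm, ← Real.rpow_def_of_pos h0, Real.rpow_natCast]
  unfold h u
  rw [e]
  have h3 : (1 - q ^ k) ≠ 0 := by linarith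
  have h4 : q ^ k ≠ 0 := by positivity
  have h5 : (q ^ k)⁻¹ - 1 = (1 - q^k) / q^k := by field_simp
  have h6 : q ^ (k - 1) * q = q ^ k := pow_sub_one_mul hk q
  rw [h5, inv_div, ← h6]
  ring

def L (a : ℕ) (q : ℝ) : ℝ := Real.log (1 - q ^ a) - 2 * Real.log (1 - q ^ (a+1))
  + 2 * Real.log (1 - q ^ (a+3)) - Real.log (1 - q ^ (a+4))

lemma one_sub_pos {q : ℝ} (hq : q ∈ Set.Ioo (0:ℝ) 1) {k : ℕ} (hk : k ≠ 0) : 0 < 1 - q ^ k := by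
  have := pow_lt_one₀ hq.1.le hq.2 hk
  linarith

lemma hasDerivAt_log {q : ℝ} (hq : q ∈ Set.Ioo (0:ℝ) 1) (k : ℕ) (hk : k ≠ 0) :
    HasDerivAt (fun q : ℝ => Real.log (1 - q ^ k)) (-(k * q ^ (k-1) / (1 - q ^ k))) q := by
  have := ((hasDerivAt_pow k q).const_sub 1).log (one_sub_pos hq hk).ne'
  refine this.congr_deriv ?_
  ring

lemma L_anti (a : ℕ) (ha : a ≠ 0) : StrictAntiOn (L a) (Set.Ioo 0 1) := by
  have hd := fun (q : ℝ) (hq : q ∈ Set.Ioo (0:ℝ) 1) =>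
    (((hasDerivAt_log hq a ha).sub ((hasDerivAt_log hq (a+1) (by simp)).const_mul 2)).add
    ((hasDerivAt_log hq (a+3) (by simp)).const_mul 2)).sub (hasDerivAt_log hq (a+4) (by simp))
  have hd : ∀ (q : ℝ) (hq : q ∈ Set.Ioo (0:ℝ) 1), HasDerivAt (L a) _ q := hd
  apply strictAntiOn_of_deriv_neg (convex_Ioo 0 1)
  · exact fun z hz => (hd z hz).continuousAt.continuousWithinAt
  · intro q hq
    rw [interior_Ioo] at hq
    rw [(hd q hq).deriv]
    have ht : 0 < -Real.log q := by
      have := Real.log_neg hq.1 hq.2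
      linarith
    have hm : 0 < q * (-Real.log q) := mul_pos hq.1 ht
    have e0 := pow_h hq a ha
    have e1 := pow_h hq (a+1) (by simp)
    have e3 := pow_h hq (a+3) (by simp)
    have e4 := pow_h hq (a+4) (by simp)
    have hap : (0:ℝ) < a := by positivity
    have hi := h_ineq (mul_pos hap ht) ht
    rw [show (a:ℝ) * -Real.log q + -Real.log q = ((a+1:ℕ):ℝ) * -Real.log q by push_cast; ring,
      show (a:ℝ) * -Real.log q + 3 * -Real.log q = ((a+3:ℕ):ℝ) * -Real.log q by push_cast; ring,
      show (a:ℝ) * -Real.log q + 4 * -Real.log q = ((a+4:ℕ):ℝ) * -Real.log q by push_cast; ring,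
      ← e0, ← e1, ← e3, ← e4] at hi
    by_contra hc
    push Not at hc
    have := mul_nonneg hc hm.le
    linarith

def F (a : ℕ) (q : ℝ) : ℝ :=
  (1 - q ^ a) * (1 - q ^ (a+3)) ^ 2 / ((1 - q ^ (a+1)) ^ 2 * (1 - q ^ (a+4)))

lemma F_pos (a : ℕ) (ha : a ≠ 0) {q : ℝ} (hq : q ∈ Set.Ioo (0:ℝ) 1) : 0 < F a q := by
  have e0 := one_sub_pos hq ha
  have e1 := one_sub_pos hq (k := a+1) (by simp)
  have e3 := one_sub_pos hq (k := a+3) (by simp)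
  have e4 := one_sub_pos hq (k := a+4) (by simp)
  unfold F
  positivity

lemma log_F (a : ℕ) (ha : a ≠ 0) {q : ℝ} (hq : q ∈ Set.Ioo (0:ℝ) 1) :
    Real.log (F a q) = L a q := by
  have e0 := one_sub_pos hq ha
  have e1 := one_sub_pos hq (k := a+1) (by simp)
  have e3 := one_sub_pos hq (k := a+3) (by simp)
  have e4 := one_sub_pos hq (k := a+4) (by simp)
  unfold F L
  rw [Real.log_div (by positivity) (by positivity), Real.log_mul (by positivity) (by positivity),
    Real.log_mul (by positivity) (by positivity), Real.log_pow, Real.log_pow]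
  push_cast
  ring

lemma F_anti (a : ℕ) (ha : a ≠ 0) : StrictAntiOn (F a) (Set.Ioo 0 1) := by
  intro x hx y hy hxy
  have := L_anti a ha hx hy hxy
  rw [← log_F a ha hx, ← log_F a ha hy] at this
  exact (Real.log_lt_log_iff (F_pos a ha hy) (F_pos a ha hx)).1 this

/-! Finite identity of Shanks. -/

def P (x : ℝ) (n : ℕ) : ℝ := ∏ k ∈ Finset.range n, ((1 - x ^ (2*k+2)) / (1 - x ^ (2*k+1)))

lemma P_succ (x : ℝ) (n : ℕ) :
    P x (n+1) = P x n * ((1 - x ^ (2*n+2)) / (1 - x ^ (2*n+1))) := by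
  rw [P, P, Finset.prod_range_succ]

lemma P_ge_one {x : ℝ} (hx : x ∈ Set.Ioo (0:ℝ) 1) (n : ℕ) : 1 ≤ P x n := by
  induction n with
  | zero => simp [P]
  | succ n ih =>
    rw [P_succ]
    apply one_le_mul_of_one_le_of_one_le ih
    rw [one_le_div (one_sub_pos hx (by simp))]
    have : x ^ (2*n+2) ≤ x ^ (2*n+1) := pow_le_pow_of_le_one hx.1.le hx.2.le (by simp)
    linarith

lemma tele {x : ℝ} (hx : x ∈ Set.Ioo (0:ℝ) 1) (n m : ℕ) :
    ∑ s ∈ Finset.range m, (P x (n+1) / P x s * x ^ (s * (2*n+3)) - P x n / P x s * x ^ (s*(2*n+1)))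
    = (1 - x ^ (2*m)) / P x m * P x n * x ^ (m * (2*n+1)) / (1 - x ^ (2*n+1)) := by
  induction m with
  | zero => simp
  | succ m ih =>
    rw [Finset.sum_range_succ, ih, P_succ, P_succ]
    have hm := P_ge_one hx m
    have hm' : P x m ≠ 0 := by linarith
    have c1 := (one_sub_pos hx (k := 2*n+1) (by simp)).ne'
    have c2 := (one_sub_pos hx (k := 2*m+1) (by simp)).ne'
    have c3 := (one_sub_pos hx (k := 2*m+2) (by simp)).ne'
    rw [show 2 * (m+1) = 2*m+2 by ring]
    have c3' : (1 - x ^ (2*m+2)) / (P x m * ((1 - x ^ (2*m+2)) / (1 - x ^ (2*m+1)))) =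
      (1 - x ^ (2*m+1)) / P x m := by
      field_simp
    rw [c3', show m * (2*n+3) = m * (2*n+1) + 2*m by ring,
      show (m+1) * (2*n+1) = m*(2*n+1) + (2*n+1) by ring, pow_add _ (m*(2*n+1)),
      pow_add _ (m*(2*n+1)) (2*n+1)]
    generalize hA : x ^ (m*(2*n+1)) = A
    have e1 : x ^ (2*n+2) = x^(2*n+1) * x := by ring
    have e2 : x ^ (2*m+1) = x^(2*m) * x := by ring
    rw [e1, e2]
    field_simp
    ring

lemma shanks {x : ℝ} (hx : x ∈ Set.Ioo (0:ℝ) 1) (n : ℕ) :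
    ∑ s ∈ Finset.range (2*n), x ^ (s*(s+1)/2) =
      ∑ s ∈ Finset.range n, P x n / P x s * x ^ (s*(2*n+1)) := by
  induction n with
  | zero => simp
  | succ n ih =>
    have hn := P_ge_one hx n
    have hn' : P x n ≠ 0 := by linarith
    have hn1 := P_ge_one hx (n+1)
    have hn1' : P x (n+1) ≠ 0 := by linarith
    have c1 := (one_sub_pos hx (k := 2*n+1) (by simp)).ne'
    have c2 := (one_sub_pos hx (k := 2*n+2) (by simp)).ne'
    have ht := tele hx n (n+1)
    rw [Finset.sum_sub_distrib, Finset.sum_range_succ (fun s => P x n / P x s * x ^ (s*(2*n+1))),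
      ← ih] at ht
    rw [show 2*(n+1) = 2*n+1+1 by ring, Finset.sum_range_succ, Finset.sum_range_succ]
    rw [show 2*n+1+1+1 = 2*n+3 by ring]
    rw [show 2*n*(2*n+1)/2 = n*(2*n+1) by
        rw [mul_assoc]; exact Nat.mul_div_cancel_left _ (by norm_num),
      show (2*n+1)*(2*n+1+1)/2 = (n+1)*(2*n+1) by
        rw [show (2*n+1)*(2*n+1+1) = 2*((n+1)*(2*n+1)) by ring]
        exact Nat.mul_div_cancel_left _ (by norm_num)]
    have e : (1 - x ^ (2*(n+1))) / P x (n+1) * P x n * x ^ ((n+1) * (2*n+1)) / (1 - x ^ (2*n+1))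
        = x ^ ((n+1) * (2*n+1)) := by
      rw [P_succ, show 2*(n+1) = 2*n+2 by ring]
      field_simp
    rw [e, div_self hn'] at ht
    linarith

lemma summable_tri {x : ℝ} (hx : x ∈ Set.Ioo (0:ℝ) 1) :
    Summable (fun s : ℕ => x ^ (s*(s+1)/2)) := by
  refine Summable.of_nonneg_of_le (fun s => by have := hx.1; positivity) (fun s => ?_)
    (summable_geometric_of_lt_one hx.1.le hx.2)
  apply pow_le_pow_of_le_one hx.1.le hx.2.le
  rcases s with _ | s
  · simp
  · rw [Nat.le_div_iff_mul_le (by norm_num)]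
    nlinarith

lemma tendsto_P {x : ℝ} (hx : x ∈ Set.Ioo (0:ℝ) 1) :
    Tendsto (P x) atTop (𝓝 (∑' s : ℕ, x ^ (s*(s+1)/2))) := by
  have hS : Tendsto (fun n : ℕ => ∑ s ∈ Finset.range (2*n), x ^ (s*(s+1)/2)) atTop
      (𝓝 (∑' s : ℕ, x ^ (s*(s+1)/2))) :=
    (summable_tri hx).hasSum.tendsto_sum_nat.comp
      (tendsto_atTop_mono (fun n => by simp only [id]; omega) tendsto_id)
  have hy : Tendsto (fun n : ℕ => x ^ (2*n+1)) atTop (𝓝 0) := by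
    refine (tendsto_pow_atTop_nhds_zero_of_lt_one hx.1.le hx.2).comp
      (tendsto_atTop_mono (fun n => ?_) tendsto_id)
    simp only [id]; omega
  have hl : Tendsto (fun n : ℕ => (∑ s ∈ Finset.range (2*n), x ^ (s*(s+1)/2)) * (1 - x ^ (2*n+1)))
      atTop (𝓝 (∑' s : ℕ, x ^ (s*(s+1)/2))) := by
    have := hS.mul (hy.const_sub 1)
    simpa using this
  refine tendsto_of_tendsto_of_tendsto_of_le_of_le' hl hS ?_ ?_
  · refine Eventually.of_forall fun n => ?_
    have hc := one_sub_pos hx (k := 2*n+1) (by simp)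
    rw [shanks hx, ← le_div_iff₀ hc]
    calc ∑ s ∈ Finset.range n, P x n / P x s * x ^ (s*(2*n+1))
        ≤ ∑ s ∈ Finset.range n, P x n * (x ^ (2*n+1)) ^ s := by
          apply Finset.sum_le_sum
          intro s _
          rw [mul_comm s, pow_mul]
          have h0 := hx.1
          have := P_ge_one hx n
          have := div_le_self (by linarith : 0 ≤ P x n) (P_ge_one hx s)
          gcongr
      _ = P x n * ∑ s ∈ Finset.range n, (x ^ (2*n+1)) ^ s := by rw [Finset.mul_sum]
      _ ≤ P x n * (1 - x ^ (2*n+1))⁻¹ := by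
          have h0 := hx.1
          have := P_ge_one hx n
          have hlt : x ^ (2*n+1) < 1 := by linarith
          have := (summable_geometric_of_lt_one (by positivity) hlt).sum_le_tsum (Finset.range n)
            (fun s _ => by positivity)
          rw [tsum_geometric_of_lt_one (by positivity) hlt] at this
          gcongr
      _ = _ := by rw [div_eq_mul_inv]
  · filter_upwards [eventually_ge_atTop 1] with n hn
    rw [shanks hx]
    have h0 := hx.1
    have := Finset.single_le_sum (f := fun s => P x n / P x s * x ^ (s*(2*n+1)))
      (s := Finset.range n) (a := 0) (fun s _ => by
        have := P_ge_one hx n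
        have := P_ge_one hx s
        positivity) (by simp; omega)
    simpa [P] using this

def psi (x : ℝ) : ℝ := ∑' s : ℕ, x ^ (s*(s+1)/2)

lemma theta_eq {q : ℝ} (hq : q ∈ Set.Ioo (0:ℝ) 1) :
    jacobiTheta2R q = 2 * q ^ (1/4 : ℝ) * psi (q^2) := by
  have hq2 : q^2 ∈ Set.Ioo (0:ℝ) 1 := ⟨by have := hq.1; positivity,
    pow_lt_one₀ hq.1.le hq.2 (by simp)⟩
  have hs := ((summable_tri hq2).hasSum).mul_left (q ^ (1/4 : ℝ))
  have key : ∀ n : ℕ, q ^ (((n:ℝ) + 1/2)^2) = q ^ (1/4:ℝ) * (q^2) ^ (n*(n+1)/2) := by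
    intro n
    rw [← pow_mul, Nat.mul_div_cancel' (Nat.even_mul_succ_self n).two_dvd, ← Real.rpow_natCast q,
      ← Real.rpow_add hq.1]
    congr 1
    push_cast
    ring
  have h1 : HasSum (fun n : ℕ => q ^ ((((n:ℤ):ℝ) + 1/2)^2)) (q ^ (1/4 : ℝ) * psi (q^2)) := by
    simp only [Int.cast_natCast, key]
    exact hs
  have h2 : HasSum (fun n : ℕ => q ^ ((((-((n:ℤ)+1) : ℤ):ℝ) + 1/2)^2))
      (q ^ (1/4 : ℝ) * psi (q^2)) := by
    convert h1 using 3 with n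
    push_cast
    ring
  have := HasSum.of_nat_of_neg_add_one (f := fun n : ℤ => q ^ (((n:ℝ) + 1/2)^2)) h1 h2
  unfold jacobiTheta2R
  rw [this.tsum_eq]
  ring

lemma f_eq {q : ℝ} (hq : q ∈ Set.Ioo (0:ℝ) 1) :
    1 / 4 * (q ^ (-(1 / 2) : ℝ) - q ^ ((1 / 2) : ℝ)) * jacobiTheta2R q ^ 2
      = (1 - q) * psi (q^2) ^ 2 := by
  rw [theta_eq hq]
  have e : (q ^ (1/4 : ℝ))^2 = q ^ (1/2 : ℝ) := by
    rw [← Real.rpow_natCast, ← Real.rpow_mul hq.1.le]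
    norm_num
  have e2 : q ^ (-(1/2) : ℝ) * q ^ (1/2 : ℝ) = 1 := by
    rw [← Real.rpow_add hq.1]; norm_num
  have e3 : q ^ (1/2 : ℝ) * q ^ (1/2 : ℝ) = q := by
    rw [← Real.rpow_add hq.1]; norm_num
  rw [mul_pow, mul_pow, e]
  linear_combination (psi (q^2))^2 * e2 - (psi (q^2))^2 * e3

lemma prod_F {q : ℝ} (hq : q ∈ Set.Ioo (0:ℝ) 1) (N : ℕ) :
    ∏ j ∈ Finset.range N, F (4*j+1) q = (1 - q) / (1 - q ^ (4*N+1)) * P (q^2) N ^ 2 := by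
  induction N with
  | zero =>
    have : 1 - q ≠ 0 := by have := hq.2; linarith
    simp [P, div_self this]
  | succ N ih =>
    rw [Finset.prod_range_succ, ih, P_succ]
    have c1 := (one_sub_pos hq (k := 4*N+1) (by simp)).ne'
    have c2 := (one_sub_pos hq (k := 4*N+2) (by simp)).ne'
    have c5 := (one_sub_pos hq (k := 4*N+5) (by simp)).ne'
    unfold F
    rw [← pow_mul, ← pow_mul, show 2*(2*N+2) = 4*N+4 by ring, show 2*(2*N+1) = 4*N+2 by ring,
      show 4*(N+1)+1 = 4*N+5 by ring, show 4*N+1+1 = 4*N+2 by ring,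
      show 4*N+1+3 = 4*N+4 by ring, show 4*N+1+4 = 4*N+5 by ring]
    field_simp

lemma tendsto_prod {q : ℝ} (hq : q ∈ Set.Ioo (0:ℝ) 1) :
    Tendsto (fun N => ∏ j ∈ Finset.range (N+1), F (4*j+1) q) atTop
      (𝓝 ((1 - q) * psi (q^2) ^ 2)) := by
  have hq2 : q^2 ∈ Set.Ioo (0:ℝ) 1 := ⟨by have := hq.1; positivity,
    pow_lt_one₀ hq.1.le hq.2 (by simp)⟩
  have hy : Tendsto (fun n : ℕ => q ^ (4*n+1)) atTop (𝓝 0) := by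
    refine (tendsto_pow_atTop_nhds_zero_of_lt_one hq.1.le hq.2).comp
      (tendsto_atTop_mono (fun n => ?_) tendsto_id)
    simp only [id]; omega
  have h1 : Tendsto (fun N => ∏ j ∈ Finset.range N, F (4*j+1) q) atTop
      (𝓝 ((1 - q) * psi (q^2) ^ 2)) := by
    simp only [prod_F hq]
    have := ((tendsto_const_nhds (x := 1 - q)).div (hy.const_sub 1) (by norm_num)).mul
      ((tendsto_P hq2).pow 2)
    simpa [psi] using this
  exact h1.comp (tendsto_add_atTop_nat 1)

end ThetaAux

open ThetaAux in
/-- The function `f(q) = (1/4)(q^{−1/2} − q^{1/2}) θ₂(q)²` is strictly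
decreasing on `(0, 1)`. -/
theorem theta_ratio_strictAnti :
    StrictAntiOn
      (fun q : ℝ => 1 / 4 * (q ^ (-(1 / 2) : ℝ) - q ^ ((1 / 2) : ℝ)) * jacobiTheta2R q ^ 2)
      (Set.Ioo 0 1) := by
  intro x hx y hy hxy
  simp only
  rw [f_eq hx, f_eq hy]
  have hx2 : x^2 ∈ Set.Ioo (0:ℝ) 1 := ⟨by have := hx.1; positivity,
    pow_lt_one₀ hx.1.le hx.2 (by simp)⟩
  have hpsi : 1 ≤ psi (x^2) := ge_of_tendsto' (tendsto_P hx2) (P_ge_one hx2)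
  have hpos : 0 < (1 - x) * psi (x^2) ^ 2 := by
    have : 0 < 1 - x := by have := hx.2; linarith
    positivity
  have hle : (1 - y) * psi (y^2) ^ 2 ≤ F 1 y / F 1 x * ((1 - x) * psi (x^2) ^ 2) := by
    refine le_of_tendsto_of_tendsto' (tendsto_prod hy) ((tendsto_prod hx).const_mul _) fun N => ?_
    rw [Finset.prod_range_succ', Finset.prod_range_succ']
    have hF := F_pos 1 (by simp) hx
    have hFy := F_pos 1 (by simp) hy
    have hp : ∏ k ∈ Finset.range N, F (4*(k+1)+1) y ≤ ∏ k ∈ Finset.range N, F (4*(k+1)+1) x :=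
      Finset.prod_le_prod (fun i _ => (F_pos _ (by simp) hy).le)
        (fun i _ => (F_anti _ (by simp) hx hy hxy).le)
    simp only [mul_zero, zero_add]
    calc _ ≤ (∏ k ∈ Finset.range N, F (4*(k+1)+1) x) * F 1 y := by gcongr
      _ = _ := by field_simp
  have hlt : F 1 y / F 1 x < 1 := by
    rw [div_lt_one (F_pos 1 (by simp) hx)]
    exact F_anti 1 (by simp) hx hy hxy
  calc _ ≤ _ := hle
    _ < 1 * ((1 - x) * psi (x^2) ^ 2) := by gcongr
    _ = _ := one_mul _
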